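/- Let n ≥ 1 be an integer and let i ∈ {1,2}. For all real numbers x, y with ⟨x−y⟩_i^{j+1} ≠ 0, the kernel satisfies K_{n−1}^{(0,j)}(x,y) = (j! / (‖M_{n−1}‖² · ⟨x−y⟩_i^{j+1})) · ( M_n(x) · ∑_{k=0}^{j} (𝒟_i^k M_{n−1}(y)/k!) · ⟨x−y⟩_i^k − M_{n−1}(x) · ∑_{k=0}^{j} (𝒟_i^k M_n(y)/k!) · ⟨x−y⟩_i^k ). -/

import Mathlib

open Finset Filter Topology Polynomial

noncomputable section

/-- Pochhammer symbol `(a)_k = a(a+1)⋯(a+k−1)`. -/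
def poch (a : ℝ) (k : ℕ) : ℝ := ∏ m ∈ Finset.range k, (a + m)

/-- Falling factorial `[x]_k = x(x−1)⋯(x−k+1)`. -/
def fall (x : ℝ) (k : ℕ) : ℝ := ∏ m ∈ Finset.range k, (x - m)

/-- `⟨x⟩_i^k`: falling factorial for `i = 1`, Pochhammer symbol for `i = 2`. -/
def br (i : ℕ) (x : ℝ) (k : ℕ) : ℝ := if i = 1 then fall x k else poch x k

/-- Forward (`i = 1`) resp. backward (`i = 2`) difference operator `𝒟_i`. -/
def Dop (i : ℕ) (f : ℝ → ℝ) : ℝ → ℝ :=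
  fun x => if i = 1 then f (x + 1) - f x else f x - f (x - 1)

/-- Iterated difference operator `𝒟_i^k`. -/
def Dk (i k : ℕ) (f : ℝ → ℝ) : ℝ → ℝ := (Dop i)^[k] f

/-- Kronecker delta `δ_{i,m}` (real valued). -/
def kdelta (i m : ℕ) : ℝ := if i = m then 1 else 0

/-- The shift `x ± 1`: `x + 1` for `i = 1`, `x - 1` for `i = 2`. -/
def sh (i : ℕ) (x : ℝ) : ℝ := if i = 1 then x + 1 else x - 1

/-- Monic Meixner polynomial `M_n(x)`. -/
def MeixnerM (γ μ : ℝ) (n : ℕ) (x : ℝ) : ℝ :=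
  poch γ n * (μ / (μ - 1)) ^ n *
    ∑ k ∈ Finset.range (n + 1),
      poch (-(n : ℝ)) k * poch (-x) k / poch γ k * (1 - μ⁻¹) ^ k / (Nat.factorial k : ℝ)

/-- Meixner inner product `⟨p,q⟩ = ∑_{x≥0} p(x)q(x) μ^x (γ)_x / x!`. -/
def mIP (γ μ : ℝ) (p q : ℝ → ℝ) : ℝ :=
  ∑' x : ℕ, p x * q x * μ ^ x * poch γ x / (Nat.factorial x : ℝ)

/-- Squared Meixner norm `‖M_n‖²`. -/
def nrm2 (γ μ : ℝ) (n : ℕ) : ℝ := mIP γ μ (MeixnerM γ μ n) (MeixnerM γ μ n)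

/-- Kernel `K_n^{(l,m)}(x,y)` for the operator `𝒟_i`. -/
def Klm (γ μ : ℝ) (i l m n : ℕ) (x y : ℝ) : ℝ :=
  ∑ k ∈ Finset.range (n + 1),
    Dk i l (MeixnerM γ μ k) x * Dk i m (MeixnerM γ μ k) y / nrm2 γ μ k

/-- Sobolev inner product `⟨p,q⟩_λ = ⟨p,q⟩ + λ 𝒟_i^j p(α) 𝒟_i^j q(α)`. -/
def sIP (γ μ lam α : ℝ) (i j : ℕ) (p q : ℝ → ℝ) : ℝ :=
  mIP γ μ p q + lam * Dk i j p α * Dk i j q α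

/-- `Q` is the monic Sobolev orthogonal polynomial of degree `n`. -/
def IsSobolevOP (γ μ lam α : ℝ) (i j n : ℕ) (Q : Polynomial ℝ) : Prop :=
  Q.Monic ∧ Q.natDegree = n ∧
    ∀ p : Polynomial ℝ, p.degree < (n : WithBot ℕ) →
      sIP γ μ lam α i j (fun x => Q.eval x) (fun x => p.eval x) = 0

/-- Coefficient `a_n^{(k)}`. -/
def acoef (γ μ lam α : ℝ) (i j n k : ℕ) : ℝ :=
  -(lam * (Nat.factorial j : ℝ) * Dk i j (MeixnerM γ μ n) α * Dk i k (MeixnerM γ μ (n - 1)) α) /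
    ((Nat.factorial k : ℝ) * nrm2 γ μ (n - 1) * (1 + lam * Klm γ μ i j j (n - 1) α α))

/-- Coefficient `b_n^{(k)}`. -/
def bcoef (γ μ lam α : ℝ) (i j n k : ℕ) : ℝ :=
  lam * (Nat.factorial j : ℝ) * Dk i j (MeixnerM γ μ n) α * Dk i k (MeixnerM γ μ n) α /
    ((Nat.factorial k : ℝ) * nrm2 γ μ (n - 1) * (1 + lam * Klm γ μ i j j (n - 1) α α))

/-- Rational function `A_{1,n}(x)`. -/
def A1 (γ μ lam α : ℝ) (i j n : ℕ) (x : ℝ) : ℝ :=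
  1 + (1 / br i (x - α) (j + 1)) *
    ∑ k ∈ Finset.range (j + 1), acoef γ μ lam α i j n k * br i (x - α) k

/-- Rational function `B_{1,n}(x)`. -/
def B1 (γ μ lam α : ℝ) (i j n : ℕ) (x : ℝ) : ℝ :=
  (1 / br i (x - α) (j + 1)) *
    ∑ k ∈ Finset.range (j + 1), bcoef γ μ lam α i j n k * br i (x - α) k

/-- Meixner recurrence coefficient `α_n`. -/
def alphaR (γ μ : ℝ) (n : ℕ) : ℝ := ((n : ℝ) * (1 + μ) + μ * γ) / (1 - μ)

/-- Meixner recurrence coefficient `β_n`. -/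
def betaR (γ μ : ℝ) (n : ℕ) : ℝ := (n : ℝ) * μ * ((n : ℝ) + γ - 1) / (1 - μ) ^ 2

/-- Rational function `A_{2,n}(x)`. -/
def A2 (γ μ lam α : ℝ) (i j n : ℕ) (x : ℝ) : ℝ :=
  -(B1 γ μ lam α i j (n - 1) x) / betaR γ μ (n - 1)

/-- Rational function `B_{2,n}(x)`. -/
def B2 (γ μ lam α : ℝ) (i j n : ℕ) (x : ℝ) : ℝ :=
  A1 γ μ lam α i j (n - 1) x + A2 γ μ lam α i j n x * (alphaR γ μ (n - 1) - x)

/-- Rational function `C_{1,n}(x)`. -/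
def C1 (γ μ lam α : ℝ) (i j n : ℕ) (x : ℝ) : ℝ :=
  (x + γ * kdelta i 1) * Dop i (A1 γ μ lam α i j n) x + (n : ℝ) * A1 γ μ lam α i j n (sh i x)
    - ((n : ℝ) - 1) * ((n : ℝ) + γ - 2) * μ ^ kdelta i 2 * B1 γ μ lam α i j n (sh i x) /
        (betaR γ μ (n - 1) * (1 - μ))

/-- Rational function `D_{1,n}(x)`. -/
def D1 (γ μ lam α : ℝ) (i j n : ℕ) (x : ℝ) : ℝ :=
  (x + γ * kdelta i 1) * Dop i (B1 γ μ lam α i j n) x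
    + ((n : ℝ) - 1) * B1 γ μ lam α i j n (sh i x)
    + ((n : ℝ) - 1) * ((n : ℝ) + γ - 2) * (x - alphaR γ μ (n - 1)) * μ ^ kdelta i 2 *
        B1 γ μ lam α i j n (sh i x) / (betaR γ μ (n - 1) * (1 - μ))
    + (n : ℝ) * ((n : ℝ) + γ - 1) * μ ^ kdelta i 2 * A1 γ μ lam α i j n (sh i x) / (1 - μ)

/-- Rational function `C_{2,n}(x)`. -/
def C2 (γ μ lam α : ℝ) (i j n : ℕ) (x : ℝ) : ℝ :=
  -(D1 γ μ lam α i j (n - 1) x) / betaR γ μ (n - 1)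

/-- Rational function `D_{2,n}(x)`. -/
def D2 (γ μ lam α : ℝ) (i j n : ℕ) (x : ℝ) : ℝ :=
  C1 γ μ lam α i j (n - 1) x + C2 γ μ lam α i j n x * (alphaR γ μ (n - 1) - x)

/-- `A_{m,n}(x)` for `m = 1, 2`. -/
def Aa (γ μ lam α : ℝ) (i j n m : ℕ) (x : ℝ) : ℝ :=
  if m = 1 then A1 γ μ lam α i j n x else A2 γ μ lam α i j n x

/-- `B_{m,n}(x)` for `m = 1, 2`. -/
def Bb (γ μ lam α : ℝ) (i j n m : ℕ) (x : ℝ) : ℝ :=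
  if m = 1 then B1 γ μ lam α i j n x else B2 γ μ lam α i j n x

/-- `C_{k,n}(x)` for `k = 1, 2`. -/
def Cc (γ μ lam α : ℝ) (i j n k : ℕ) (x : ℝ) : ℝ :=
  if k = 1 then C1 γ μ lam α i j n x else C2 γ μ lam α i j n x

/-- `D_{k,n}(x)` for `k = 1, 2`. -/
def Dd (γ μ lam α : ℝ) (i j n k : ℕ) (x : ℝ) : ℝ :=
  if k = 1 then D1 γ μ lam α i j n x else D2 γ μ lam α i j n x

/-- `Λ_{m,n}^{(k)}(x) = (−1)^k (C_{k,n}(x) B_{m,n}(x) − A_{m,n}(x) D_{k,n}(x))`. -/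
def Lam (γ μ lam α : ℝ) (i j n m k : ℕ) (x : ℝ) : ℝ :=
  (-1 : ℝ) ^ k * (Cc γ μ lam α i j n k x * Bb γ μ lam α i j n m x
    - Aa γ μ lam α i j n m x * Dd γ μ lam α i j n k x)

/-- `Θ_n(x) = A_{1,n}(x) B_{2,n}(x) − B_{1,n}(x) A_{2,n}(x)`. -/
def Theta (γ μ lam α : ℝ) (i j n : ℕ) (x : ℝ) : ℝ :=
  A1 γ μ lam α i j n x * B2 γ μ lam α i j n x - B1 γ μ lam α i j n x * A2 γ μ lam α i j n x

/-- `Θ̃_n(x) = (x + γ δ_{i,1}) Θ_n(x)`. -/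
def Thetatil (γ μ lam α : ℝ) (i j n : ℕ) (x : ℝ) : ℝ :=
  (x + γ * kdelta i 1) * Theta γ μ lam α i j n x
lemma poch_succ (a : ℝ) (k : ℕ) : poch a (k + 1) = poch a k * (a + k) :=
  Finset.prod_range_succ _ _

lemma fall_succ (x : ℝ) (k : ℕ) : fall x (k + 1) = fall x k * (x - k) :=
  Finset.prod_range_succ _ _

lemma poch_pos {a : ℝ} (ha : 0 < a) (k : ℕ) : 0 < poch a k :=
  Finset.prod_pos fun _ _ => by positivity

lemma poch_neg (x : ℝ) (k : ℕ) : poch (-x) k = (-1) ^ k * fall x k := by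
  induction k with
  | zero => simp [poch, fall]
  | succ k ih => rw [poch_succ, fall_succ, ih, pow_succ]; ring

lemma fall_add_one (x : ℝ) (k : ℕ) : fall (x + 1) (k + 1) = (x + 1) * fall x k := by
  rw [fall, Finset.prod_range_succ', fall, mul_comm]
  simp

lemma choose_succ_mul (n k : ℕ) :
    ((k : ℝ) + 1) * (n.choose (k + 1) : ℝ) = ((n : ℝ) - k) * n.choose k := by
  have h := Nat.add_one_mul_choose_eq n k
  rw [Nat.choose_succ_succ] at h
  have h' : ((n : ℝ) + 1) * n.choose k = (n.choose k + n.choose (k + 1)) * (k + 1) := by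
    exact_mod_cast h
  linarith

lemma fall_natCast (n k : ℕ) : fall n k = n.choose k * (Nat.factorial k : ℝ) := by
  induction k with
  | zero => simp [fall]
  | succ k ih =>
    rw [fall_succ, ih, Nat.factorial_succ]
    push_cast
    linear_combination (-(k.factorial : ℝ)) * choose_succ_mul n k

/-- Coefficient of the falling factorial `[x]_k` in `M_n(x)`. -/
def meixnerCoeff (γ μ : ℝ) (n k : ℕ) : ℝ :=
  n.choose k * (μ / (μ - 1)) ^ n * ((μ - 1) / μ) ^ k * poch γ n / poch γ k

lemma meixnerM_eq_sum (γ : ℝ) {μ : ℝ} (hμ : μ ≠ 0) (n : ℕ) (x : ℝ) :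
    MeixnerM γ μ n x = ∑ k ∈ range (n + 1), meixnerCoeff γ μ n k * fall x k := by
  rw [MeixnerM, Finset.mul_sum]
  refine Finset.sum_congr rfl fun k _ => ?_
  have hb : 1 - μ⁻¹ = (μ - 1) / μ := by field_simp
  have hs : ((-1 : ℝ) ^ k) * (-1) ^ k = 1 := by rw [← mul_pow]; simp
  have hf : (k.factorial : ℝ) ≠ 0 := by positivity
  rw [poch_neg, poch_neg, fall_natCast, hb, meixnerCoeff]
  calc _ = ((-1 : ℝ) ^ k * (-1) ^ k) * ((k.factorial : ℝ) / k.factorial) *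
        (n.choose k * (μ / (μ - 1)) ^ n * ((μ - 1) / μ) ^ k * poch γ n / poch γ k * fall x k) := by
        ring
    _ = _ := by rw [hs, div_self hf]; ring

lemma meixnerCoeff_of_lt (γ μ : ℝ) {n k : ℕ} (h : n < k) : meixnerCoeff γ μ n k = 0 := by
  simp [meixnerCoeff, Nat.choose_eq_zero_of_lt h]

lemma meixnerM_eq_sum_of_lt (γ : ℝ) {μ : ℝ} (hμ : μ ≠ 0) {n N : ℕ} (h : n < N) (x : ℝ) :
    MeixnerM γ μ n x = ∑ k ∈ range N, meixnerCoeff γ μ n k * fall x k := by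
  rw [meixnerM_eq_sum γ hμ]
  refine Finset.sum_subset (Finset.range_mono h) fun k _ hk => ?_
  rw [meixnerCoeff_of_lt, zero_mul]
  simpa using hk

lemma betaR_mul_meixnerCoeff (γ : ℝ) {μ : ℝ} (h0 : μ ≠ 0) (h1 : μ - 1 ≠ 0)
    (n k : ℕ) :
    betaR γ μ n * meixnerCoeff γ μ (n - 1) k =
      ((n : ℝ) - k) / (μ - 1) * meixnerCoeff γ μ n k := by
  rcases n with _ | n
  · rcases k with _ | k
    · simp [betaR]
    · simp [betaR, meixnerCoeff]
  · have hc : ((n : ℝ) + 1) * n.choose k = ((n : ℝ) + 1 - k) * (n + 1).choose k := by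
      have e1 := choose_succ_mul n k
      have e2 := choose_succ_mul (n + 1) k
      have e3 : ((n + 1).choose (k + 1) : ℝ) = n.choose k + n.choose (k + 1) := by
        exact_mod_cast Nat.choose_succ_succ n k
      rw [e3] at e2
      push_cast at e2
      linarith
    have hsq : (1 - μ) ^ 2 = (μ - 1) ^ 2 := by ring
    rw [betaR, Nat.add_sub_cancel, meixnerCoeff, meixnerCoeff, poch_succ, pow_succ _ n, hsq]
    push_cast
    calc _ = (((n : ℝ) + 1) * n.choose k) * (μ * (γ + n) / (μ - 1) ^ 2 *
          ((μ / (μ - 1)) ^ n * ((μ - 1) / μ) ^ k * poch γ n / poch γ k)) := by ring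
      _ = _ := by
        rw [hc]
        field_simp

lemma meixnerM_recurrence {γ μ : ℝ} (hγ : 0 < γ) (h0 : μ ≠ 0) (h1 : μ - 1 ≠ 0)
    (n : ℕ) (x : ℝ) :
    x * MeixnerM γ μ n x = MeixnerM γ μ (n + 1) x + alphaR γ μ n * MeixnerM γ μ n x +
      betaR γ μ n * MeixnerM γ μ (n - 1) x := by
  have shift : x * MeixnerM γ μ n x = ∑ k ∈ range (n + 1), meixnerCoeff γ μ n k * fall x (k + 1) +
      ∑ k ∈ range (n + 2), k * meixnerCoeff γ μ n k * fall x k := by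
    rw [Finset.sum_range_succ _ (n + 1), meixnerCoeff_of_lt _ _ (Nat.lt_succ_self n),
      meixnerM_eq_sum γ h0, Finset.mul_sum, mul_zero, zero_mul, add_zero, ← Finset.sum_add_distrib]
    refine Finset.sum_congr rfl fun k _ => ?_
    rw [fall_succ]; ring
  rw [shift, meixnerM_eq_sum γ h0 (n + 1), meixnerM_eq_sum_of_lt γ h0 (show n < n + 2 by omega),
    meixnerM_eq_sum_of_lt γ h0 (show n - 1 < n + 2 by omega), Finset.mul_sum, Finset.mul_sum]
  simp only [Finset.sum_range_succ' _ (n + 1)]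
  have hzero : alphaR γ μ n * meixnerCoeff γ μ n 0 + meixnerCoeff γ μ (n + 1) 0 +
      betaR γ μ n * meixnerCoeff γ μ (n - 1) 0 = 0 := by
    rw [betaR_mul_meixnerCoeff γ h0 h1]
    simp only [meixnerCoeff, alphaR, poch_succ, pow_succ, Nat.choose_zero_right]
    push_cast
    have : 1 - μ = -(μ - 1) := by ring
    rw [this]
    field_simp
    ring
  have hsucc : ∀ k, meixnerCoeff γ μ n k + ((k : ℝ) + 1) * meixnerCoeff γ μ n (k + 1) =
      meixnerCoeff γ μ (n + 1) (k + 1) + alphaR γ μ n * meixnerCoeff γ μ n (k + 1) +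
        betaR γ μ n * meixnerCoeff γ μ (n - 1) (k + 1) := by
    intro k
    rw [betaR_mul_meixnerCoeff γ h0 h1]
    have hp := (poch_pos hγ k).ne'
    have hk : γ + k ≠ 0 := by positivity
    have hc := choose_succ_mul n k
    simp only [meixnerCoeff, alphaR, poch_succ, pow_succ, Nat.choose_succ_succ]
    push_cast
    have : 1 - μ = -(μ - 1) := by ring
    rw [this]
    generalize (n.choose (k + 1) : ℝ) = c' at hc ⊢
    generalize (n.choose k : ℝ) = c at hc ⊢
    field_simp
    linear_combination poch γ n * μ * hc
  have hsum : ∑ k ∈ range (n + 1), meixnerCoeff γ μ n k * fall x (k + 1) +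
      ∑ k ∈ range (n + 1), ((k + 1 : ℕ) : ℝ) * meixnerCoeff γ μ n (k + 1) * fall x (k + 1) =
      ∑ k ∈ range (n + 1), meixnerCoeff γ μ (n + 1) (k + 1) * fall x (k + 1) +
      ∑ k ∈ range (n + 1), alphaR γ μ n * (meixnerCoeff γ μ n (k + 1) * fall x (k + 1)) +
      ∑ k ∈ range (n + 1), betaR γ μ n * (meixnerCoeff γ μ (n - 1) (k + 1) * fall x (k + 1)) := by
    simp only [← Finset.sum_add_distrib]
    refine Finset.sum_congr rfl fun k _ => ?_
    push_cast
    linear_combination fall x (k + 1) * hsucc k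
  rw [← add_assoc, hsum]
  push_cast
  linear_combination (-fall x 0) * hzero

/-- Weight of the Meixner inner product. -/
def meixnerWeight (γ μ : ℝ) (x : ℕ) : ℝ := μ ^ x * poch γ x / (Nat.factorial x : ℝ)

lemma meixnerWeight_pos {γ μ : ℝ} (hγ : 0 < γ) (h0 : 0 < μ) (x : ℕ) :
    0 < meixnerWeight γ μ x := by
  have := poch_pos hγ x
  unfold meixnerWeight
  positivity

lemma meixnerWeight_succ (γ μ : ℝ) (x : ℕ) :
    ((x : ℝ) + 1) * meixnerWeight γ μ (x + 1) = μ * (γ + x) * meixnerWeight γ μ x := by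
  have : (x.factorial : ℝ) ≠ 0 := by positivity
  have : (x : ℝ) + 1 ≠ 0 := by positivity
  rw [meixnerWeight, meixnerWeight, poch_succ, pow_succ, Nat.factorial_succ]
  push_cast
  field_simp

lemma summable_pow_mul_meixnerWeight {γ μ : ℝ} (hγ : 0 < γ) (h0 : 0 < μ) (h1 : μ < 1) (k : ℕ) :
    Summable fun x : ℕ => (x : ℝ) ^ k * meixnerWeight γ μ x := by
  have hpos : ∀ x : ℕ, 1 ≤ x → 0 < (x : ℝ) ^ k * meixnerWeight γ μ x := fun x hx => by
    have := meixnerWeight_pos hγ h0 x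
    positivity
  refine summable_of_ratio_test_tendsto_lt_one h1 ?_ ?_
  · filter_upwards [eventually_ge_atTop 1] with x hx
    exact (hpos x hx).ne'
  · have hinv : Tendsto (fun x : ℕ => ((x : ℝ))⁻¹) atTop (𝓝 0) := tendsto_inv_atTop_nhds_zero_nat
    have hlim : Tendsto (fun x : ℕ => (1 + (x : ℝ)⁻¹) ^ k *
        (μ * (γ * (x : ℝ)⁻¹ + 1) / (1 + (x : ℝ)⁻¹))) atTop
        (𝓝 ((1 + 0) ^ k * (μ * (γ * 0 + 1) / (1 + 0)))) :=
      ((hinv.const_add 1).pow k).mul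
        ((((hinv.const_mul γ).add_const 1).const_mul μ).div (hinv.const_add 1) (by norm_num))
    have he : ((1 : ℝ) + 0) ^ k * (μ * (γ * 0 + 1) / (1 + 0)) = μ := by simp
    rw [he] at hlim
    refine hlim.congr' ?_
    filter_upwards [eventually_ge_atTop 1] with x hx
    rw [Real.norm_of_nonneg (hpos x hx).le, Real.norm_of_nonneg (hpos (x + 1) (by omega)).le]
    have hx0 : (x : ℝ) ≠ 0 := by positivity
    have hx1 : (x : ℝ) + 1 ≠ 0 := by positivity
    have hw := (meixnerWeight_pos hγ h0 x).ne'
    have hs : meixnerWeight γ μ (x + 1) = μ * (γ + x) * meixnerWeight γ μ x / (x + 1) := by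
      rw [eq_div_iff hx1, mul_comm, meixnerWeight_succ]
    have e : (1 : ℝ) + (x : ℝ)⁻¹ = (x + 1) / x := by field_simp
    rw [hs, e, div_pow]
    push_cast
    field_simp

lemma summable_eval_mul_meixnerWeight {γ μ : ℝ} (hγ : 0 < γ) (h0 : 0 < μ) (h1 : μ < 1)
    (p : ℝ[X]) : Summable fun x : ℕ => p.eval (x : ℝ) * meixnerWeight γ μ x := by
  induction p using Polynomial.induction_on' with
  | add p q hp hq => simpa [add_mul] using hp.add hq
  | monomial k a =>
    simpa [mul_assoc] using (summable_pow_mul_meixnerWeight hγ h0 h1 k).mul_left a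

/-- The falling factorial `[X]_k` as a polynomial. -/
def fallPoly (k : ℕ) : ℝ[X] := ∏ m ∈ range k, (X - C (m : ℝ))

lemma eval_fallPoly (k : ℕ) (x : ℝ) : (fallPoly k).eval x = fall x k := by
  simp [fallPoly, fall, Polynomial.eval_prod]

/-- The Meixner polynomial as an element of `ℝ[X]`. -/
def meixnerPoly (γ μ : ℝ) (n : ℕ) : ℝ[X] :=
  ∑ k ∈ range (n + 1), C (meixnerCoeff γ μ n k) * fallPoly k

lemma eval_meixnerPoly (γ : ℝ) {μ : ℝ} (h0 : μ ≠ 0) (n : ℕ) (x : ℝ) :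
    (meixnerPoly γ μ n).eval x = MeixnerM γ μ n x := by
  simp [meixnerPoly, meixnerM_eq_sum γ h0, Polynomial.eval_finsetSum, eval_fallPoly]

lemma tsum_fall_mul_meixnerWeight {γ μ : ℝ} (hγ : 0 < γ) (h0 : 0 < μ) (h1 : μ < 1) (k : ℕ) :
    ∑' x : ℕ, fall x k * meixnerWeight γ μ x =
      poch γ k * (μ / (1 - μ)) ^ k * ∑' x : ℕ, meixnerWeight γ μ x := by
  induction k with
  | zero => simp [fall, poch]
  | succ k ih =>
    have hsum : ∀ k, Summable fun x : ℕ => fall x k * meixnerWeight γ μ x := fun k => by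
      simpa [eval_fallPoly] using summable_eval_mul_meixnerWeight hγ h0 h1 (fallPoly k)
    have step : ∑' x : ℕ, fall x (k + 1) * meixnerWeight γ μ x =
        μ * (γ + k) * ∑' x : ℕ, fall x k * meixnerWeight γ μ x +
          μ * ∑' x : ℕ, fall x (k + 1) * meixnerWeight γ μ x := by
      conv_lhs => rw [(hsum (k + 1)).tsum_eq_zero_add]
      have hz : fall ((0 : ℕ) : ℝ) (k + 1) = 0 := by rw [fall_natCast]; simp
      rw [hz, zero_mul, zero_add, ← tsum_mul_left, ← tsum_mul_left,
        ← ((hsum k).mul_left _).tsum_add ((hsum (k + 1)).mul_left _)]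
      refine tsum_congr fun x => ?_
      push_cast
      rw [fall_add_one, fall_succ]
      linear_combination fall x k * meixnerWeight_succ γ μ x
    have hne : 1 - μ ≠ 0 := by linarith
    rw [ih] at step
    rw [poch_succ, pow_succ]
    field_simp at step ⊢
    linear_combination step

lemma tsum_meixnerM_mul_meixnerWeight {γ μ : ℝ} (hγ : 0 < γ) (h0 : 0 < μ) (h1 : μ < 1) {n : ℕ}
    (hn : n ≠ 0) : ∑' x : ℕ, MeixnerM γ μ n x * meixnerWeight γ μ x = 0 := by
  have hne : μ - 1 ≠ 0 := by linarith
  have hsum : ∀ k, Summable fun x : ℕ => fall x k * meixnerWeight γ μ x := fun k => by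
    simpa [eval_fallPoly] using summable_eval_mul_meixnerWeight hγ h0 h1 (fallPoly k)
  simp only [meixnerM_eq_sum γ h0.ne', Finset.sum_mul, mul_assoc]
  rw [Summable.tsum_finsetSum fun k _ => (hsum k).mul_left _]
  simp only [tsum_mul_left, tsum_fall_mul_meixnerWeight hγ h0 h1]
  have key : ∑ k ∈ range (n + 1), ((-1 : ℝ)) ^ k * n.choose k = 0 := by
    have := add_pow (-1 : ℝ) 1 n
    simpa [hn] using this.symm
  rw [← mul_zero ((μ / (μ - 1)) ^ n * poch γ n * ∑' x : ℕ, meixnerWeight γ μ x), ← key,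
    Finset.mul_sum]
  refine Finset.sum_congr rfl fun k _ => ?_
  have hs : ((μ - 1) / μ) ^ k * (μ / (1 - μ)) ^ k = (-1) ^ k := by
    rw [← mul_pow]
    congr 1
    have : 1 - μ = -(μ - 1) := by ring
    rw [this]
    field_simp
  have hp := (poch_pos hγ k).ne'
  rw [meixnerCoeff, ← hs]
  field_simp

lemma mIP_eq_tsum (γ μ : ℝ) (p q : ℝ → ℝ) :
    mIP γ μ p q = ∑' x : ℕ, p x * q x * meixnerWeight γ μ x := by
  simp only [mIP, meixnerWeight, mul_assoc, mul_div_assoc]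

lemma meixnerM_zero (γ μ x : ℝ) : MeixnerM γ μ 0 x = 1 := by
  simp [MeixnerM, poch]

lemma mIP_recurrence {γ μ : ℝ} (hγ : 0 < γ) (h0 : 0 < μ) (h1 : μ < 1) (m n : ℕ) :
    mIP γ μ (MeixnerM γ μ (m + 1)) (MeixnerM γ μ n) +
        alphaR γ μ m * mIP γ μ (MeixnerM γ μ m) (MeixnerM γ μ n) +
        betaR γ μ m * mIP γ μ (MeixnerM γ μ (m - 1)) (MeixnerM γ μ n) =
      mIP γ μ (MeixnerM γ μ m) (MeixnerM γ μ (n + 1)) +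
        alphaR γ μ n * mIP γ μ (MeixnerM γ μ m) (MeixnerM γ μ n) +
        betaR γ μ n * mIP γ μ (MeixnerM γ μ m) (MeixnerM γ μ (n - 1)) := by
  have hs : ∀ a b, Summable fun x : ℕ =>
      MeixnerM γ μ a x * MeixnerM γ μ b x * meixnerWeight γ μ x := fun a b => by
    simpa [eval_meixnerPoly γ h0.ne'] using
      summable_eval_mul_meixnerWeight hγ h0 h1 (meixnerPoly γ μ a * meixnerPoly γ μ b)
  have h1' : μ - 1 ≠ 0 := by linarith
  simp only [mIP_eq_tsum, ← tsum_mul_left]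
  rw [← (hs _ _).tsum_add ((hs _ _).mul_left _), ← (hs _ _).tsum_add ((hs _ _).mul_left _),
    ← ((hs _ _).add ((hs _ _).mul_left _)).tsum_add ((hs _ _).mul_left _),
    ← ((hs _ _).add ((hs _ _).mul_left _)).tsum_add ((hs _ _).mul_left _)]
  refine tsum_congr fun x => ?_
  linear_combination meixnerWeight γ μ x *
    (MeixnerM γ μ m x * meixnerM_recurrence hγ h0.ne' h1' n x -
      MeixnerM γ μ n x * meixnerM_recurrence hγ h0.ne' h1' m x)

lemma mIP_meixnerM_of_lt {γ μ : ℝ} (hγ : 0 < γ) (h0 : 0 < μ) (h1 : μ < 1) (m : ℕ) :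
    ∀ n, m < n → mIP γ μ (MeixnerM γ μ m) (MeixnerM γ μ n) = 0 := by
  induction m using Nat.strong_induction_on with
  | _ m ih =>
    intro n hn
    rcases m with _ | m
    · simpa [mIP_eq_tsum, meixnerM_zero] using
        tsum_meixnerM_mul_meixnerWeight hγ h0 h1 (n := n) (by omega)
    · have h := mIP_recurrence hγ h0 h1 m n
      rw [ih m (by omega) n (by omega), ih m (by omega) (n + 1) (by omega),
        ih m (by omega) (n - 1) (by omega), ih (m - 1) (by omega) n (by omega)] at h
      linarith

lemma nrm2_succ {γ μ : ℝ} (hγ : 0 < γ) (h0 : 0 < μ) (h1 : μ < 1) (n : ℕ) :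
    nrm2 γ μ (n + 1) = betaR γ μ (n + 1) * nrm2 γ μ n := by
  have h := mIP_recurrence hγ h0 h1 n (n + 1)
  rw [mIP_meixnerM_of_lt hγ h0 h1 n (n + 1) (by omega),
    mIP_meixnerM_of_lt hγ h0 h1 n (n + 1 + 1) (by omega),
    mIP_meixnerM_of_lt hγ h0 h1 (n - 1) (n + 1) (by omega), Nat.add_sub_cancel] at h
  unfold nrm2
  linarith

lemma betaR_succ_pos {γ μ : ℝ} (hγ : 0 < γ) (h0 : 0 < μ) (h1 : μ < 1) (n : ℕ) :
    0 < betaR γ μ (n + 1) := by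
  have h : 0 < 1 - μ := by linarith
  have h' : ((n + 1 : ℕ) : ℝ) + γ - 1 = n + γ := by push_cast; ring
  rw [betaR, h']
  positivity

lemma nrm2_pos {γ μ : ℝ} (hγ : 0 < γ) (h0 : 0 < μ) (h1 : μ < 1) (n : ℕ) : 0 < nrm2 γ μ n := by
  induction n with
  | zero =>
    have hs : Summable (meixnerWeight γ μ) := by
      simpa using summable_pow_mul_meixnerWeight hγ h0 h1 0
    simpa [nrm2, mIP_eq_tsum, meixnerM_zero] using
      hs.tsum_pos (fun x => (meixnerWeight_pos hγ h0 x).le) 0 (meixnerWeight_pos hγ h0 0)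
  | succ n ih =>
    rw [nrm2_succ hγ h0 h1]
    exact mul_pos (betaR_succ_pos hγ h0 h1 n) ih

/-- Christoffel–Darboux formula for the Meixner polynomials. -/
lemma christoffel_darboux {γ μ : ℝ} (hγ : 0 < γ) (h0 : 0 < μ) (h1 : μ < 1) (n : ℕ) (x y : ℝ) :
    (x - y) * ∑ k ∈ range (n + 1), MeixnerM γ μ k x * MeixnerM γ μ k y / nrm2 γ μ k =
      (MeixnerM γ μ (n + 1) x * MeixnerM γ μ n y -
        MeixnerM γ μ n x * MeixnerM γ μ (n + 1) y) / nrm2 γ μ n := by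
  have h1' : μ - 1 ≠ 0 := by linarith
  have hr := fun n z => meixnerM_recurrence hγ h0.ne' h1' n z
  induction n with
  | zero =>
    have hb : betaR γ μ 0 = 0 := by simp [betaR]
    have hx := hr 0 x
    have hy := hr 0 y
    rw [hb] at hx hy
    rw [Finset.sum_range_one, ← mul_div_assoc]
    congr 1
    linear_combination MeixnerM γ μ 0 y * hx - MeixnerM γ μ 0 x * hy
  | succ n ih =>
    have hN := (nrm2_pos hγ h0 h1 n).ne'
    have hB := (betaR_succ_pos hγ h0 h1 n).ne'
    have hx := hr (n + 1) x
    have hy := hr (n + 1) y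
    rw [Nat.add_sub_cancel] at hx hy
    rw [Finset.sum_range_succ, mul_add, ih, nrm2_succ hγ h0 h1]
    field_simp
    linear_combination MeixnerM γ μ (n + 1) y * hx - MeixnerM γ μ (n + 1) x * hy

lemma Dk_zero (i : ℕ) (f : ℝ → ℝ) : Dk i 0 f = f := rfl

lemma Dk_succ (i k : ℕ) (f : ℝ → ℝ) : Dk i (k + 1) f = Dop i (Dk i k f) :=
  Function.iterate_succ_apply' _ _ _

lemma Dk_sum_mul {ι : Type*} (i j : ℕ) (s : Finset ι) (c : ι → ℝ) (f : ι → ℝ → ℝ) :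
    Dk i j (fun y => ∑ k ∈ s, c k * f k y) = fun y => ∑ k ∈ s, c k * Dk i j (f k) y := by
  induction j with
  | zero => rfl
  | succ j ih =>
    funext y
    simp only [Dk_succ, ih, Dop]
    split_ifs <;> simp only [← Finset.sum_sub_distrib, mul_sub]

lemma Dk_mul_sub_mul (i j : ℕ) (a b : ℝ) (f g : ℝ → ℝ) :
    Dk i j (fun y => a * f y - b * g y) = fun y => a * Dk i j f y - b * Dk i j g y := by
  simpa [Fin.sum_univ_two, sub_eq_add_neg] using
    Dk_sum_mul i j Finset.univ ![a, -b] ![f, g]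

lemma br_zero (i : ℕ) (x : ℝ) : br i x 0 = 1 := by simp [br, fall, poch]

/-- `⟨x⟩_i^{k+1}` is `⟨x⟩_i^k` times the linear factor `x ∓ k`. -/
lemma br_succ (i : ℕ) (x : ℝ) (k : ℕ) :
    br i x (k + 1) = br i x k * (x + if i = 1 then -(k : ℝ) else k) := by
  unfold br
  split_ifs
  · rw [fall_succ, sub_eq_add_neg]
  · rw [poch_succ]

/-- Leibniz rule for `𝒟_i^{m+1}` applied to a product with a linear factor. -/
lemma Dk_succ_sub_mul (i m : ℕ) (x : ℝ) (g : ℝ → ℝ) :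
    Dk i (m + 1) (fun y => (x - y) * g y) = fun y =>
      (x - y + if i = 1 then -((m + 1 : ℕ) : ℝ) else ((m + 1 : ℕ) : ℝ)) * Dk i (m + 1) g y -
        (m + 1) * Dk i m g y := by
  induction m with
  | zero =>
    funext y
    simp only [Dk_succ, Dk_zero, Dop]
    split_ifs <;> push_cast <;> ring
  | succ m ih =>
    funext y
    rw [Dk_succ, ih, Dk_succ i (m + 1) g, Dk_succ i m g]
    simp only [Dop]
    split_ifs <;> push_cast <;> ring

/-- Discrete Taylor-type identity for a function divisible by `x - y`. -/
lemma sum_Dk_sub_mul (i j : ℕ) (x y : ℝ) (g : ℝ → ℝ) :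
    ∑ k ∈ range (j + 1), Dk i k (fun y => (x - y) * g y) y / (Nat.factorial k : ℝ) *
        br i (x - y) k = br i (x - y) (j + 1) * Dk i j g y / (Nat.factorial j : ℝ) := by
  induction j with
  | zero => simp [br_succ, br_zero, Dk_zero]
  | succ j ih =>
    have hf : (j.factorial : ℝ) ≠ 0 := by positivity
    have hj : (j : ℝ) + 1 ≠ 0 := by positivity
    rw [Finset.sum_range_succ, ih, Dk_succ_sub_mul, br_succ i (x - y) (j + 1), Nat.factorial_succ]
    push_cast
    field_simp
    ring

/-- representation of the kernel `K_{n−1}^{(0,j)}(x,y)`. -/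
theorem kernel_0j_representation (γ μ : ℝ) (hγ : 0 < γ) (hμ0 : 0 < μ) (hμ1 : μ < 1)
    (j i : ℕ) (hi : i = 1 ∨ i = 2) (n : ℕ) (hn : 1 ≤ n) (x y : ℝ)
    (hxy : br i (x - y) (j + 1) ≠ 0) :
    Klm γ μ i 0 j (n - 1) x y =
      (Nat.factorial j : ℝ) / (nrm2 γ μ (n - 1) * br i (x - y) (j + 1)) *
        (MeixnerM γ μ n x *
            ∑ k ∈ Finset.range (j + 1),
              Dk i k (MeixnerM γ μ (n - 1)) y / (Nat.factorial k : ℝ) * br i (x - y) k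
          - MeixnerM γ μ (n - 1) x *
            ∑ k ∈ Finset.range (j + 1),
              Dk i k (MeixnerM γ μ n) y / (Nat.factorial k : ℝ) * br i (x - y) k) := by
  obtain ⟨n, rfl⟩ : ∃ m, n = m + 1 := ⟨n - 1, by omega⟩
  rw [Nat.add_sub_cancel]
  have hN := (nrm2_pos hγ hμ0 hμ1 n).ne'
  have hf : (j.factorial : ℝ) ≠ 0 := by positivity
  set g : ℝ → ℝ := fun y => ∑ k ∈ range (n + 1), MeixnerM γ μ k x / nrm2 γ μ k * MeixnerM γ μ k y
    with hg
  have hK : Klm γ μ i 0 j n x y = Dk i j g y := by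
    rw [hg, Dk_sum_mul, Klm]
    exact Finset.sum_congr rfl fun k _ => by rw [Dk_zero]; ring
  have hF : (fun y => (x - y) * g y) = fun y =>
      MeixnerM γ μ (n + 1) x / nrm2 γ μ n * MeixnerM γ μ n y -
        MeixnerM γ μ n x / nrm2 γ μ n * MeixnerM γ μ (n + 1) y := by
    funext z
    have h := christoffel_darboux hγ hμ0 hμ1 n x z
    simp only [hg, div_mul_eq_mul_div, h, sub_div]
  have hT := sum_Dk_sub_mul i j x y g
  simp only [hF, Dk_mul_sub_mul] at hT
  have hS : nrm2 γ μ n * (br i (x - y) (j + 1) * Dk i j g y / (j.factorial : ℝ)) =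
      MeixnerM γ μ (n + 1) x *
          ∑ k ∈ range (j + 1), Dk i k (MeixnerM γ μ n) y / (k.factorial : ℝ) * br i (x - y) k -
        MeixnerM γ μ n x *
          ∑ k ∈ range (j + 1),
            Dk i k (MeixnerM γ μ (n + 1)) y / (k.factorial : ℝ) * br i (x - y) k := by
    rw [← hT, Finset.mul_sum, Finset.mul_sum, Finset.mul_sum, ← Finset.sum_sub_distrib]
    refine Finset.sum_congr rfl fun k _ => ?_
    field_simp
  rw [hK, ← hS]
  field_simp
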